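/- Let U be a normal ultrafilter on a measurable cardinal δ. If there exists a regular cardinal κ > δ⁺ and a cardinal θ ∈ {κ, κ⁺} with the property that there exists a □(θ)-sequence, then there exists a limit ordinal λ of cofinality θ and an unbounded subset of λ that is fresh over Ult(V,U). -/

import Mathlib

noncomputable section

open Cardinal Set

namespace MU

/-- The type of ordinals below the initial ordinal of `δ`, serving as the underlying
set of the cardinal `δ` and indexing the ultrapower. -/
abbrev Idx (δ : Cardinal.{0}) : Type 1 := {o : Ordinal.{0} // o < δ.ord}

/-- A filter `F` is `κ`-complete (equivalently, `<κ`-closed): it is closed under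
intersections of fewer than `κ` of its members. -/
def IsCComplete (κ : Cardinal.{0}) {X : Type*} (F : Filter X) : Prop :=
  ∀ (ι : Type) (t : ι → Set X), #ι < κ → (∀ j, t j ∈ F) → (⋂ j, t j) ∈ F

/-- `U` is a normal ultrafilter on the measurable cardinal `δ`: `δ` is uncountable and
`U` is a `δ`-complete nonprincipal ultrafilter on `δ` such that every function that is
regressive on a set in `U` is constant on a set in `U`. -/
structure IsNormalUltrafilter (δ : Cardinal.{0}) (U : Ultrafilter (Idx δ)) : Prop where
  uncountable : ℵ₀ < δ
  complete : IsCComplete δ (U : Filter (Idx δ))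
  nonprincipal : ∀ i : Idx δ, ({i} : Set (Idx δ)) ∉ U
  normal : ∀ f : Idx δ → Ordinal.{0}, { i : Idx δ | f i < i.1 } ∈ U →
    ∃ c : Ordinal.{0}, { i : Idx δ | f i = c } ∈ U

variable {δ : Cardinal.{0}} {U : Ultrafilter (Idx δ)}

/-- The Łoś ordering on representatives of ordinals of the ultrapower `Ult(V,U)`. -/
def ultLT (U : Ultrafilter (Idx δ)) (f g : Idx δ → Ordinal.{0}) : Prop :=
  { i : Idx δ | f i < g i } ∈ U

theorem ultLT_wf (hU : IsNormalUltrafilter δ U) : WellFounded (ultLT U) := by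
  haveI : IsIrrefl (Idx δ → Ordinal.{0}) (ultLT U) := by
    constructor
    intro f hf
    have h : ({ i : Idx δ | f i < f i } : Set (Idx δ)) = ∅ := by ext i; simp
    rw [ultLT, h] at hf
    exact Filter.empty_notMem (U : Filter (Idx δ)) hf
  haveI : IsTrans (Idx δ → Ordinal.{0}) (ultLT U) := by
    constructor
    intro f g h hfg hgh
    have hsub : ({ i : Idx δ | f i < g i } ∩ { i : Idx δ | g i < h i } : Set (Idx δ)) ⊆
        { i : Idx δ | f i < h i } := fun i hi => show f i < h i from lt_trans hi.1 hi.2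
    exact Filter.mem_of_superset (Filter.inter_mem hfg hgh) hsub
  haveI : IsStrictOrder (Idx δ → Ordinal.{0}) (ultLT U) := ⟨⟩
  rw [RelEmbedding.wellFounded_iff_isEmpty]
  constructor
  intro g
  have hmem : ∀ n : ℕ, { i : Idx δ | g (n + 1) i < g n i } ∈ U :=
    fun n => g.map_rel_iff.2 (Nat.lt_succ_self n)
  have hint : (⋂ n : ℕ, { i : Idx δ | g (n + 1) i < g n i }) ∈ U := by
    refine hU.complete ℕ _ ?_ hmem
    rw [Cardinal.mk_nat]
    exact hU.uncountable
  obtain ⟨i, hi⟩ := Ultrafilter.nonempty_of_mem hint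
  have hdesc : ∀ n : ℕ, (fun n => g n i) (n + 1) < (fun n => g n i) n :=
    fun n => Set.mem_iInter.1 hi n
  exact (RelEmbedding.wellFounded_iff_isEmpty.1 Ordinal.lt_wf).false
    (RelEmbedding.natGT (fun n => g n i) hdesc)

/-- The ordinal represented by `f` in the transitive collapse of the ultrapower
`Ult(V,U)`, i.e. the rank of `f` in the (well-founded) Łoś ordering. -/
def ordRank (hU : IsNormalUltrafilter δ U) (f : Idx δ → Ordinal.{0}) : Ordinal.{0} :=
  sInf { o : Ordinal.{0} | Ordinal.lift.{1} o = ((ultLT_wf hU).apply f).rank }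

/-- The image of an ordinal under the ultrapower embedding `j_U : V → Ult(V,U)`. -/
def jU (hU : IsNormalUltrafilter δ U) (o : Ordinal.{0}) : Ordinal.{0} :=
  ordRank hU fun _ => o

/-- The set of ordinals that is the transitive collapse of the element of the
ultrapower `Ult(V,U)` represented by the function `f`. -/
def ultSet (hU : IsNormalUltrafilter δ U) (f : Idx δ → Set Ordinal.{0}) :
    Set Ordinal.{0} :=
  { o : Ordinal.{0} |
    ∃ g : Idx δ → Ordinal.{0}, { i : Idx δ | g i ∈ f i } ∈ U ∧ ordRank hU g = o }

/-- A set of ordinals is (the transitive collapse of) an element of the ultrapower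
`Ult(V,U)`. -/
def InUlt (hU : IsNormalUltrafilter δ U) (A : Set Ordinal.{0}) : Prop :=
  ∃ f : Idx δ → Set Ordinal.{0}, (∀ i, BddAbove (f i)) ∧ A = ultSet hU f

/-- The least upper bound of a set of ordinals. -/
def lub (A : Set Ordinal.{0}) : Ordinal.{0} :=
  sSup ((fun o => o + 1) '' A)

/-- Hamkins: a set `A` of ordinals is fresh over `Ult(V,U)` if `A ∉ Ult(V,U)` but
`A ∩ α ∈ Ult(V,U)` for every `α < lub A`. -/
def Fresh (hU : IsNormalUltrafilter δ U) (A : Set Ordinal.{0}) : Prop :=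
  ¬ InUlt hU A ∧ ∀ α < lub A, InUlt hU (A ∩ Iio α)

/-- `A` is an unbounded subset of the ordinal `l`. -/
def UnbSub (A : Set Ordinal.{0}) (l : Ordinal.{0}) : Prop :=
  A ⊆ Iio l ∧ ∀ b < l, ∃ a ∈ A, b ≤ a

/-- `A` is a closed subset of the ordinal `l`: it contains the suprema of all of its
nonempty subsets that are bounded below `l`. -/
def ClosedIn (A : Set Ordinal.{0}) (l : Ordinal.{0}) : Prop :=
  ∀ S ⊆ A, S.Nonempty → sSup S < l → sSup S ∈ A

/-- The set of limit points of a set of ordinals. -/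
def limitPts (A : Set Ordinal.{0}) : Set Ordinal.{0} :=
  { b : Ordinal.{0} | (A ∩ Iio b).Nonempty ∧ sSup (A ∩ Iio b) = b }

/-- `S` is a stationary subset of the ordinal `l`. -/
def StationaryIn (S : Set Ordinal.{0}) (l : Ordinal.{0}) : Prop :=
  S ⊆ Iio l ∧ ∀ D : Set Ordinal.{0}, ClosedIn D l → UnbSub D l → (S ∩ D).Nonempty

/-- The order type of the set of ordinals `C` is at most `o`. -/
def otpLE (C : Set Ordinal.{0}) (o : Ordinal.{0}) : Prop :=
  ∃ g : Ordinal.{0} → Ordinal.{0}, (∀ a ∈ C, g a < o) ∧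
    ∀ a ∈ C, ∀ b ∈ C, a < b → g a < g b

/-- The order type of the set of ordinals `C` is (strictly) less than `o`. -/
def otpLT (C : Set Ordinal.{0}) (o : Ordinal.{0}) : Prop :=
  ∃ o' < o, otpLE C o'

/-- `C` is a `□(Θ)`-sequence, where `Θ` is (the initial ordinal of) an uncountable
regular cardinal. -/
structure IsSquareSeq (Θ : Ordinal.{0}) (C : Ordinal.{0} → Set Ordinal.{0}) : Prop where
  closed : ∀ γ < Θ, Order.IsSuccLimit γ → ClosedIn (C γ) γ
  unbounded : ∀ γ < Θ, Order.IsSuccLimit γ → UnbSub (C γ) γ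
  coherent : ∀ γ < Θ, Order.IsSuccLimit γ → ∀ β ∈ limitPts (C γ), β < γ → C β = C γ ∩ Iio β
  nontrivial : ¬ ∃ D : Set Ordinal.{0}, ClosedIn D Θ ∧ UnbSub D Θ ∧
    ∀ γ ∈ limitPts D, γ < Θ → D ∩ Iio γ = C γ

/-- `C` is a `□_κ`-sequence: a `□(κ⁺)`-sequence all of whose clubs have order type
at most `κ`. -/
def IsSquareKappaSeq (κ : Cardinal.{0}) (C : Ordinal.{0} → Set Ordinal.{0}) : Prop :=
  IsSquareSeq (Order.succ κ).ord C ∧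
    ∀ γ < (Order.succ κ).ord, Order.IsSuccLimit γ → otpLE (C γ) κ.ord

/-- `κ` is a weakly compact cardinal: `κ` is uncountable and every coloring of the
pairs of ordinals below `κ` in fewer than `κ` colors has a homogeneous set of size `κ`. -/
def IsWeaklyCompact (κ : Cardinal.{0}) : Prop :=
  ℵ₀ < κ ∧ ∀ (ν : Type) (c : Ordinal.{0} → Ordinal.{0} → ν), #ν < κ →
    ∃ H : Set Ordinal.{0}, H ⊆ Iio κ.ord ∧ Cardinal.lift.{1} κ ≤ #H ∧
      ∀ a ∈ H, ∀ b ∈ H, ∀ a' ∈ H, ∀ b' ∈ H, a < b → a' < b' → c a b = c a' b'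

/-- `κ` is a strongly compact cardinal: every `κ`-complete filter (on any set)
extends to a `κ`-complete ultrafilter. -/
def IsStronglyCompact (κ : Cardinal.{0}) : Prop :=
  ∀ (X : Type) (F : Filter X), IsCComplete κ F →
    ∃ G : Ultrafilter X, F ≤ (G : Filter X) ∧ IsCComplete κ (G : Filter X)

/-- `κ` is a singular cardinal. -/
def IsSingular (κ : Cardinal.{0}) : Prop :=
  ℵ₀ ≤ κ ∧ κ.ord.cof < κ

/-- The cofinality of the ordinal `l` as computed inside the ultrapower `Ult(V,U)`
(as an ordinal, i.e. the image of the ultrapower's cofinality under the transitive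
collapse). -/
def cofUlt (hU : IsNormalUltrafilter δ U) (l : Ordinal.{0}) : Ordinal.{0} :=
  sInf { c : Ordinal.{0} | ∃ f : Idx δ → Ordinal.{0},
    ordRank hU f = l ∧ ordRank hU (fun i => ((f i).cof).ord) = c }

/-- The ordinal `o` is (the transitive collapse of) a cardinal of the ultrapower
`Ult(V,U)`. -/
def CardInUlt (hU : IsNormalUltrafilter δ U) (o : Ordinal.{0}) : Prop :=
  ∃ f : Idx δ → Ordinal.{0}, ordRank hU f = o ∧
    { i : Idx δ | ((f i).card).ord = f i } ∈ U

/-- The ordinal `o` is (the transitive collapse of) a regular cardinal of the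
ultrapower `Ult(V,U)`. -/
def RegularInUlt (hU : IsNormalUltrafilter δ U) (o : Ordinal.{0}) : Prop :=
  ∃ f : Idx δ → Ordinal.{0}, ordRank hU f = o ∧
    { i : Idx δ | ((f i).card).IsRegular ∧ ((f i).card).ord = f i } ∈ U

/-- The cardinal successor of the ordinal `o` as computed inside the ultrapower
`Ult(V,U)`: the least ordinal above `o` that is a cardinal in `Ult(V,U)`. -/
def succInUlt (hU : IsNormalUltrafilter δ U) (o : Ordinal.{0}) : Ordinal.{0} :=
  sInf { c : Ordinal.{0} | o < c ∧ CardInUlt hU c }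

/-- The cardinality of a set of ordinals, as an (initial) ordinal: the least ordinal
`o` such that `s` is the image of a function defined on the ordinals below `o`. -/
def setCardOrd (s : Set Ordinal.{0}) : Ordinal.{0} :=
  sInf { o : Ordinal.{0} | ∃ g : Ordinal.{0} → Ordinal.{0}, s ⊆ g '' Iio o }

section Combinatorics

variable {θ : Cardinal.{0}}

theorem exists_bound (hθ : θ.IsRegular) {ι : Type 1} (hι : #ι < Cardinal.lift.{1} θ)
    (f : ι → Ordinal.{0}) (hf : ∀ i, f i < θ.ord) : ∃ b < θ.ord, ∀ i, f i < b := by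
  have hc : Cardinal.lift.{0} #ι < (Ordinal.lift.{1} θ.ord).cof := by
    rw [← Ordinal.lift_cof, hθ.cof_ord]
    simpa using hι
  refine ⟨_, Ordinal.lift_iSup_add_one_lt_of_lt_cof hc hf, fun i => ?_⟩
  have hb : BddAbove (range fun i => f i + 1) := by
    refine ⟨θ.ord, ?_⟩
    rintro _ ⟨i, rfl⟩
    exact Order.add_one_le_of_lt (hf i)
  exact (Order.lt_add_one_iff.2 le_rfl).trans_le (le_ciSup hb i)

theorem mk_Iio_lt_lift {μ : Ordinal.{0}} (hμ : μ < θ.ord) :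
    #(Iio μ) < Cardinal.lift.{1} θ := by
  rw [Cardinal.mk_Iio_ordinal, Cardinal.lift_lt]
  exact Cardinal.lt_ord.1 hμ

theorem exists_bound_Iio (hθ : θ.IsRegular) {μ : Ordinal.{0}} (hμ : μ < θ.ord)
    (f : Ordinal.{0} → Ordinal.{0}) (hf : ∀ x < μ, f x < θ.ord) :
    ∃ b < θ.ord, ∀ x < μ, f x < b := by
  obtain ⟨b, hb, h⟩ := exists_bound hθ (mk_Iio_lt_lift hμ) (fun x => f x.1) fun x => hf x.1 x.2
  exact ⟨b, hb, fun x hx => h ⟨x, hx⟩⟩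

/-- Transfinite recursion for a specification that can always be extended by one value. -/
theorem exists_transfinite_seq {X : Type*} [Inhabited X]
    (Q : Ordinal.{0} → (Ordinal.{0} → X) → X → Prop)
    (hcongr : ∀ β F F' v, (∀ γ < β, F γ = F' γ) → Q β F v → Q β F' v)
    (hstep : ∀ β F, (∀ γ < β, Q γ F (F γ)) → ∃ v, Q β F v) :
    ∃ F : Ordinal.{0} → X, ∀ β, Q β F (F β) := by
  classical
  let ext : (β : Ordinal.{0}) → ((γ : Ordinal.{0}) → γ < β → X) → Ordinal.{0} → X :=
    fun β g γ => if h : γ < β then g γ h else default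
  let step : (β : Ordinal.{0}) → ((γ : Ordinal.{0}) → γ < β → X) → X :=
    fun β g => if h : ∃ v, Q β (ext β g) v then h.choose else default
  let F : Ordinal.{0} → X := Ordinal.lt_wf.fix step
  have hF : ∀ β, F β = step β fun γ _ => F γ := fun β => Ordinal.lt_wf.fix_eq step β
  refine ⟨F, fun β => ?_⟩
  induction β using Ordinal.lt_wf.induction with
  | h β ih =>
    have he : ∀ γ < β, F γ = ext β (fun γ _ => F γ) γ := fun γ hγ => by simp [ext, hγ]
    obtain ⟨v, hv⟩ := hstep β F ih
    have hex : ∃ v, Q β (ext β fun γ _ => F γ) v := ⟨v, hcongr _ _ _ _ he hv⟩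
    have hval : F β = hex.choose := by rw [hF β]; simp only [step, dif_pos hex]
    rw [hval]
    exact hcongr _ _ _ _ (fun γ hγ => (he γ hγ).symm) hex.choose_spec

/-- `S` contains closure points of every function from `θ` to `θ`; for regular uncountable
`θ` this amounts to stationarity in `θ`. -/
def Stat (θ : Cardinal.{0}) (S : Set Ordinal.{0}) : Prop :=
  ∀ G : Ordinal.{0} → Ordinal.{0}, (∀ x < θ.ord, G x < θ.ord) →
    ∃ α ∈ S, α < θ.ord ∧ α ≠ 0 ∧ ∀ x < α, G x < α

theorem Stat.mono {S T : Set Ordinal.{0}} (h : Stat θ S) (hST : S ⊆ T) : Stat θ T := by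
  intro G hG
  obtain ⟨α, hα, h⟩ := h G hG
  exact ⟨α, hST hα, h⟩

theorem Stat.inter_Ioi {S : Set Ordinal.{0}} (h : Stat θ S) {ξ : Ordinal.{0}} (hξ : ξ < θ.ord) :
    Stat θ (S ∩ Ioi ξ) := by
  intro G hG
  obtain ⟨α, hα, h1, h2, h3⟩ := h (fun x => max (G x) ξ) fun x hx => max_lt (hG x hx) hξ
  exact ⟨α, ⟨hα, (max_lt_iff.1 (h3 0 (pos_iff_ne_zero.2 h2))).2⟩, h1, h2,
    fun x hx => (max_lt_iff.1 (h3 x hx)).1⟩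

theorem isSuccLimit_of_closed {α : Ordinal.{0}} (h0 : α ≠ 0) (h : ∀ x < α, x + 1 < α) :
    Order.IsSuccLimit α := by
  rw [Ordinal.isSuccLimit_iff]
  exact ⟨h0, Order.isSuccPrelimit_of_succ_lt fun x hx => by simpa using h x hx⟩

theorem stat_isSuccLimit (hθ : θ.IsRegular) (hθ' : ℵ₀ < θ) :
    Stat θ {γ | Order.IsSuccLimit γ} := by
  intro G hG
  have hlim := Cardinal.isSuccLimit_ord hθ.aleph0_le
  have key : ∀ b < θ.ord, ∃ c < θ.ord, b < c ∧ ∀ x < b, G x < c := by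
    intro b hb
    obtain ⟨c, hc, h⟩ := exists_bound_Iio hθ hb G fun x hx => hG x (hx.trans hb)
    refine ⟨max c (b + 1), max_lt hc ?_, lt_max_of_lt_right ?_, fun x hx => lt_max_of_lt_left (h x hx)⟩
    · simpa using hlim.succ_lt hb
    · exact Order.lt_add_one_iff.2 le_rfl
  choose! s hs1 hs2 hs3 using key
  let e : ℕ → Ordinal.{0} := fun n => s^[n] 0
  have he : ∀ n, e (n + 1) = s (e n) := fun n => Function.iterate_succ_apply' s n 0
  have h0 : (0 : Ordinal.{0}) < θ.ord := hθ.ord_pos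
  have heθ : ∀ n, e n < θ.ord := by
    intro n
    induction n with
    | zero => exact h0
    | succ n ih => rw [he]; exact hs1 _ ih
  have hα : (⨆ n, e n) < θ.ord := by
    refine Ordinal.iSup_lt_of_lt_cof ?_ heθ
    rw [hθ.cof_ord]; simpa using hθ'
  have hlt : ∀ n, e n < ⨆ n, e n := fun n =>
    ((hs2 _ (heθ n)).trans_eq (he n).symm).trans_le (Ordinal.le_iSup e (n + 1))
  have hcl : ∀ x < ⨆ n, e n, ∃ n, x < e n := fun x hx => Ordinal.lt_iSup_iff.1 hx
  have hne : (⨆ n, e n) ≠ 0 := (show (0 : Ordinal.{0}) < ⨆ n, e n from hlt 0).ne'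
  refine ⟨⨆ n, e n, isSuccLimit_of_closed hne fun x hx => ?_, hα, hne, fun x hx => ?_⟩
  · obtain ⟨n, hn⟩ := hcl x hx
    exact (Order.add_one_le_of_lt hn).trans_lt (hlt n)
  · obtain ⟨n, hn⟩ := hcl x hx
    exact (hs3 _ (heθ n) x hn).trans ((he n).symm.trans_lt (hlt (n + 1)))

theorem Stat.exists_of_subset_iUnion (hθ : θ.IsRegular) {ι : Type 1}
    (hι : #ι < Cardinal.lift.{1} θ) {S : Set Ordinal.{0}} (hS : Stat θ S)
    {T : ι → Set Ordinal.{0}} (hST : S ⊆ ⋃ i, T i) : ∃ i, Stat θ (S ∩ T i) := by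
  by_contra! hcon
  simp only [Stat, not_forall] at hcon
  choose G hG hGT using hcon
  have : ∀ x < θ.ord, ∃ b < θ.ord, ∀ i, G i x < b := fun x hx =>
    exists_bound hθ hι (fun i => G i x) fun i => hG i x hx
  choose! B hB hGB using this
  obtain ⟨α, hα, h1, h2, h3⟩ := hS B hB
  obtain ⟨i, hi⟩ := mem_iUnion.1 (hST hα)
  exact hGT i ⟨α, ⟨hα, hi⟩, h1, h2, fun x hx => (hGB x (hx.trans h1) i).trans (h3 x hx)⟩

/-- Closure of the nonstationary ideal under diagonal unions. -/
theorem Stat.exists_forall_lt_notMem (hθ : θ.IsRegular) {S : Set Ordinal.{0}} (hS : Stat θ S)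
    {B : Ordinal.{0} → Set Ordinal.{0}} (hB : ∀ ζ < θ.ord, ¬ Stat θ (S ∩ B ζ)) :
    ∃ α ∈ S, ∀ ζ < α, α ∉ B ζ := by
  simp only [Stat, not_forall] at hB
  choose! G hG hGB using hB
  have hlim := Cardinal.isSuccLimit_ord hθ.aleph0_le
  have h1 : ∀ z < θ.ord, ∀ x < θ.ord, ∃ b < θ.ord, ∀ y < x, G z y < b := fun z hz x hx =>
    exists_bound_Iio hθ hx (G z) fun y hy => hG z hz y (hy.trans hx)
  choose! K hK hGK using h1
  have h2 : ∀ x < θ.ord, ∃ b < θ.ord, ∀ z < x + 1, K z (x + 1) < b := fun x hx => by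
    have hx1 : x + 1 < θ.ord := by simpa using hlim.succ_lt hx
    exact exists_bound_Iio hθ hx1 (fun z => K z (x + 1)) fun z hz => hK z (hz.trans hx1) _ hx1
  choose! M hM hKM using h2
  obtain ⟨α, hα, hαθ, h0, hcl⟩ := hS M hM
  refine ⟨α, hα, fun ζ hζ hmem => hGB ζ (hζ.trans hαθ) ⟨α, ⟨hα, hmem⟩, hαθ, h0, fun x hx => ?_⟩⟩
  have hm : max x ζ < α := max_lt hx hζ
  have hmθ := hm.trans hαθ
  have hm1 : max x ζ + 1 < θ.ord := by simpa using hlim.succ_lt hmθ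
  calc G ζ x < K ζ (max x ζ + 1) :=
        hGK ζ (hζ.trans hαθ) _ hm1 x (Order.lt_add_one_iff.2 (le_max_left _ _))
    _ < M (max x ζ) := hKM _ hmθ ζ (Order.lt_add_one_iff.2 (le_max_right _ _))
    _ < α := hcl _ hm

theorem mem_limitPts_iff {A : Set Ordinal.{0}} {b : Ordinal.{0}} :
    b ∈ limitPts A ↔ b ≠ 0 ∧ ∀ x < b, ∃ y ∈ A, x < y ∧ y < b := by
  have hb : BddAbove (A ∩ Iio b) := ⟨b, fun y hy => (le_of_lt hy.2)⟩
  constructor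
  · rintro ⟨hne, hs⟩
    obtain ⟨y, -, hyb⟩ := id hne
    refine ⟨fun h => ?_, fun x hx => ?_⟩
    · subst h
      exact absurd hyb (by simp)
    · rw [← hs] at hx
      obtain ⟨z, hz, hxz⟩ := exists_lt_of_lt_csSup hne hx
      exact ⟨z, hz.1, hxz, hz.2⟩
  · rintro ⟨h0, h⟩
    obtain ⟨y, hy, -, hyb⟩ := h 0 (pos_iff_ne_zero.2 h0)
    have hne : (A ∩ Iio b).Nonempty := ⟨y, hy, hyb⟩
    refine ⟨hne, le_antisymm (csSup_le hne fun z hz => le_of_lt hz.2) ?_⟩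
    refine le_of_forall_lt fun x hx => ?_
    obtain ⟨z, hz, hxz, hzb⟩ := h x hx
    exact hxz.trans_le (le_csSup hb ⟨hz, hzb⟩)

theorem isSuccLimit_of_mem_limitPts {A : Set Ordinal.{0}} {b : Ordinal.{0}}
    (hb : b ∈ limitPts A) : Order.IsSuccLimit b := by
  obtain ⟨h0, h⟩ := mem_limitPts_iff.1 hb
  refine isSuccLimit_of_closed h0 fun x hx => ?_
  obtain ⟨y, -, hxy, hyb⟩ := h x hx
  exact (Order.add_one_le_of_lt hxy).trans_lt hyb

theorem mem_limitPts_of_inter_eq {A B : Set Ordinal.{0}} {b c : Ordinal.{0}} (hbc : b ≤ c)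
    (h : A ∩ Iio c = B ∩ Iio c) (hb : b ∈ limitPts A) : b ∈ limitPts B := by
  rw [mem_limitPts_iff] at hb ⊢
  refine ⟨hb.1, fun x hx => ?_⟩
  obtain ⟨y, hy, hxy, hyb⟩ := hb.2 x hx
  have : y ∈ B ∩ Iio c := by
    rw [← h]
    exact ⟨hy, hyb.trans_le hbc⟩
  exact ⟨y, this.1, hxy, hyb⟩

theorem inter_Iio_inter_Iio (A : Set Ordinal.{0}) {b c : Ordinal.{0}} (hbc : b ≤ c) :
    A ∩ Iio c ∩ Iio b = A ∩ Iio b := by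
  ext x
  simp only [mem_inter_iff, mem_Iio]
  exact ⟨fun h => ⟨h.1.1, h.2⟩, fun h => ⟨⟨h.1, h.2.trans_le hbc⟩, h.2⟩⟩

variable {C : Ordinal.{0} → Set Ordinal.{0}}

/-- The initial segments below `ξ` of the members of a sequence of sets of ordinals. -/
def traces (θ : Cardinal.{0}) (C : Ordinal.{0} → Set Ordinal.{0}) (ξ : Ordinal.{0}) :
    Set (Set Ordinal.{0}) :=
  {s | ∃ γ < θ.ord, Order.IsSuccLimit γ ∧ s = C γ ∩ Iio ξ}

theorem traces_subset (hC : IsSquareSeq θ.ord C) (ξ : Ordinal.{0}) :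
    traces θ C ξ ⊆ ({∅} ∪ C '' Iio (ξ + 1)) ∪
      ⋃ m ∈ Iio ξ, (fun s => insert m s) '' traces θ C m := by
  rintro s ⟨γ, hγ, hlim, rfl⟩
  by_cases hmax : ∃ m, IsGreatest (C γ ∩ Iio ξ) m
  · obtain ⟨m, ⟨hm, hmξ⟩, hmax⟩ := hmax
    refine Or.inr (mem_iUnion₂.2 ⟨m, hmξ, C γ ∩ Iio m, ⟨γ, hγ, hlim, rfl⟩, ?_⟩)
    ext x
    simp only [mem_insert_iff, mem_inter_iff, mem_Iio]
    constructor
    · rintro (rfl | h)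
      · exact ⟨hm, hmξ⟩
      · exact ⟨h.1, h.2.trans hmξ⟩
    · rintro ⟨h1, h2⟩
      rcases (hmax ⟨h1, h2⟩).eq_or_lt with h | h
      · exact Or.inl h
      · exact Or.inr ⟨h1, h⟩
  · left
    rcases (C γ ∩ Iio ξ).eq_empty_or_nonempty with he | hne
    · exact Or.inl he
    · right
      have hbdd : BddAbove (C γ ∩ Iio ξ) := ⟨ξ, fun y hy => le_of_lt hy.2⟩
      set b := sSup (C γ ∩ Iio ξ) with hb
      have hbξ : b ≤ ξ := csSup_le hne fun y hy => le_of_lt hy.2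
      have hbγ : b ≤ γ := csSup_le hne fun y hy => le_of_lt ((hC.unbounded γ hγ hlim).1 hy.1)
      have hlt : ∀ y ∈ C γ ∩ Iio ξ, y < b := fun y hy =>
        lt_of_le_of_ne (le_csSup hbdd hy) fun h =>
          hmax ⟨y, hy, fun z hz => (le_csSup hbdd hz).trans_eq h.symm⟩
      have heq : C γ ∩ Iio ξ = C γ ∩ Iio b := by
        ext x
        exact ⟨fun h => ⟨h.1, hlt x h⟩, fun h => ⟨h.1, lt_of_lt_of_le h.2 hbξ⟩⟩
      refine ⟨b, Order.lt_add_one_iff.2 hbξ, ?_⟩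
      rw [heq]
      rcases hbγ.eq_or_lt with h | h
      · rw [h]
        exact (inter_eq_left.2 (hC.unbounded γ hγ hlim).1).symm
      · exact hC.coherent γ hγ hlim b ⟨heq ▸ hne, by rw [← heq]⟩ h

theorem mk_traces_lt (hθ : θ.IsRegular) (hC : IsSquareSeq θ.ord C) (ξ : Ordinal.{0})
    (hξ : ξ < θ.ord) : #(traces θ C ξ) < Cardinal.lift.{1} θ := by
  have hreg : (Cardinal.lift.{1} θ).IsRegular := hθ.lift
  induction ξ using Ordinal.lt_wf.induction with
  | h ξ ih =>
    refine (mk_le_mk_of_subset (traces_subset hC ξ)).trans_lt ((mk_union_le _ _).trans_lt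
      (add_lt_of_lt hreg.aleph0_le ((mk_union_le _ _).trans_lt
        (add_lt_of_lt hreg.aleph0_le ?_ ?_)) ?_))
    · rw [mk_singleton]
      exact one_lt_aleph0.trans_le hreg.aleph0_le
    · have hlim := Cardinal.isSuccLimit_ord hθ.aleph0_le
      exact mk_image_le.trans_lt (mk_Iio_lt_lift (by simpa using hlim.succ_lt hξ))
    · refine (card_biUnion_lt_iff_forall_of_isRegular hreg (mk_Iio_lt_lift hξ)).2 fun m hm => ?_
      exact mk_image_le.trans_lt (ih m hm (lt_trans hm hξ))

/-- The indices `γ > ξ` at which the sequence `C` has trace `a` below `ξ`. -/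
def traceSet (C : Ordinal.{0} → Set Ordinal.{0}) (ξ : Ordinal.{0}) (a : Set Ordinal.{0}) :
    Set Ordinal.{0} :=
  {γ | Order.IsSuccLimit γ ∧ ξ < γ ∧ C γ ∩ Iio ξ = a}

theorem Stat.nonempty {S : Set Ordinal.{0}} (hS : Stat θ S) : ∃ α ∈ S, α < θ.ord := by
  obtain ⟨α, h1, h2, -⟩ := hS (fun x => x) fun x hx => hx
  exact ⟨α, h1, h2⟩

theorem Stat.inter_Iio_ord {S : Set Ordinal.{0}} (hS : Stat θ S) : Stat θ (S ∩ Iio θ.ord) := by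
  intro G hG
  obtain ⟨α, hα, h1, h⟩ := hS G hG
  exact ⟨α, ⟨hα, h1⟩, h1, h⟩

theorem Stat.exists_traceSet (hθ : θ.IsRegular) (hC : IsSquareSeq θ.ord C)
    {S : Set Ordinal.{0}} (hS : Stat θ S) (hlim : ∀ γ ∈ S, Order.IsSuccLimit γ)
    {ξ : Ordinal.{0}} (hξ : ξ < θ.ord) : ∃ a, Stat θ (S ∩ traceSet C ξ a) := by
  obtain ⟨i, hi⟩ := (hS.inter_Ioi hξ).inter_Iio_ord.exists_of_subset_iUnion hθ
    (mk_traces_lt hθ hC ξ hξ) (T := fun s => traceSet C ξ s.1) (by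
      rintro γ ⟨⟨h1, h2⟩, h3⟩
      exact mem_iUnion.2 ⟨⟨_, γ, h3, hlim γ h1, rfl⟩, hlim γ h1, h2, rfl⟩)
  exact ⟨i, hi.mono fun γ hγ => ⟨hγ.1.1.1, hγ.2⟩⟩

theorem traceSet_subset {ξ η : Ordinal.{0}} (h : ξ ≤ η) (a : Set Ordinal.{0}) :
    traceSet C η a ⊆ traceSet C ξ (a ∩ Iio ξ) := by
  rintro γ ⟨h1, h2, rfl⟩
  exact ⟨h1, h.trans_lt h2, (inter_Iio_inter_Iio _ h).symm⟩

theorem Stat.exists_traceSet_extension (hθ : θ.IsRegular) (hC : IsSquareSeq θ.ord C)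
    {ξ η : Ordinal.{0}} {a : Set Ordinal.{0}} (ha : Stat θ (traceSet C ξ a)) (h : ξ ≤ η)
    (hη : η < θ.ord) : ∃ b, Stat θ (traceSet C η b) ∧ b ∩ Iio ξ = a := by
  obtain ⟨b, hb⟩ := ha.exists_traceSet hθ hC (fun γ hγ => hγ.1) hη
  obtain ⟨γ, ⟨h1, h2⟩, -⟩ := hb.nonempty
  refine ⟨b, hb.mono fun γ hγ => hγ.2, ?_⟩
  exact (traceSet_subset h b h2).2.2.symm.trans h1.2.2

/-- A trace that occurs stationarily often extends to two incompatible ones; otherwise the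
sequence would have a thread. -/
theorem exists_split (hθ : θ.IsRegular) (hC : IsSquareSeq θ.ord C)
    {ξ : Ordinal.{0}} (hξ : ξ < θ.ord) {a : Set Ordinal.{0}} (ha : Stat θ (traceSet C ξ a)) :
    ∃ η < θ.ord, ξ ≤ η ∧ ∃ b b', Stat θ (traceSet C η b) ∧ Stat θ (traceSet C η b') ∧
      b ∩ Iio ξ = a ∧ b' ∩ Iio ξ = a ∧ b ≠ b' := by
  by_contra! hcon
  have hlim := Cardinal.isSuccLimit_ord hθ.aleph0_le
  have hsucc : ∀ x < θ.ord, x + 1 < θ.ord := fun x hx => by simpa using hlim.succ_lt hx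
  have hext : ∀ η, ξ ≤ η → η < θ.ord → ∃ b, Stat θ (traceSet C η b) ∧ b ∩ Iio ξ = a :=
    fun η h1 h2 => ha.exists_traceSet_extension hθ hC h1 h2
  choose! b hbS hba using hext
  have huniq : ∀ η, ξ ≤ η → η < θ.ord → ∀ b', Stat θ (traceSet C η b') → b' ∩ Iio ξ = a →
      b' = b η := fun η h1 h2 b' h3 h4 =>
    hcon η h2 h1 b' (b η) h3 (hbS η h1 h2) h4 (hba η h1 h2)
  have hcoh : ∀ η ζ, ξ ≤ η → η ≤ ζ → ζ < θ.ord → b ζ ∩ Iio η = b η := by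
    intro η ζ h1 h2 h3
    refine huniq η h1 (h2.trans_lt h3) _ ((hbS ζ (h1.trans h2) h3).mono (traceSet_subset h2 _)) ?_
    rw [inter_Iio_inter_Iio _ h1, hba ζ (h1.trans h2) h3]
  have hbC : ∀ η, ξ ≤ η → η < θ.ord → ∃ γ < θ.ord, Order.IsSuccLimit γ ∧ η < γ ∧
      C γ ∩ Iio η = b η := by
    intro η h1 h2
    obtain ⟨γ, ⟨h3, h4, h5⟩, h6⟩ := (hbS η h1 h2).nonempty
    exact ⟨γ, h6, h3, h4, h5⟩
  have hsub : ∀ η, ξ ≤ η → η < θ.ord → b η ⊆ Iio η := by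
    intro η h1 h2
    obtain ⟨γ, -, -, -, h⟩ := hbC η h1 h2
    rw [← h]
    exact inter_subset_right
  let D : Set Ordinal.{0} := {x | ∃ η, ξ ≤ η ∧ η < θ.ord ∧ x ∈ b η}
  have hD : ∀ η, ξ ≤ η → η < θ.ord → D ∩ Iio η = b η := by
    intro η h1 h2
    ext x
    constructor
    · rintro ⟨⟨ζ, h3, h4, h5⟩, h6⟩
      rcases le_total η ζ with h | h
      · rw [← hcoh η ζ h1 h h4]
        exact ⟨h5, h6⟩
      · rw [← hcoh ζ η h3 h h2] at h5
        exact h5.1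
    · exact fun h => ⟨⟨η, h1, h2, h⟩, hsub η h1 h2 h⟩
  have hDθ : D ⊆ Iio θ.ord := by
    rintro x ⟨η, h1, h2, h3⟩
    exact lt_trans (hsub η h1 h2 h3) h2
  refine hC.nontrivial ⟨D, ?_, ⟨hDθ, ?_⟩, ?_⟩
  · intro S hSD hne hs
    have hbdd : BddAbove S := ⟨θ.ord, fun x hx => le_of_lt (hDθ (hSD hx))⟩
    set η := max ξ (sSup S + 1) with hη
    have hηθ : η < θ.ord := max_lt hξ (hsucc _ hs)
    have hlt : sSup S < η := lt_max_of_lt_right (Order.lt_add_one_iff.2 le_rfl)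
    obtain ⟨γ, h1, h2, h3, h4⟩ := hbC η (le_max_left _ _) hηθ
    have hDη := hD η (le_max_left _ _) hηθ
    have hSC : S ⊆ C γ := by
      intro x hx
      have : x ∈ C γ ∩ Iio η := by
        rw [h4, ← hDη]
        exact ⟨hSD hx, (le_csSup hbdd hx).trans_lt hlt⟩
      exact this.1
    have : sSup S ∈ C γ ∩ Iio η := ⟨hC.closed γ h1 h2 S hSC hne (hlt.trans h3), hlt⟩
    rw [h4, ← hDη] at this
    exact this.1
  · by_contra! hbd
    obtain ⟨β, hβ, hbd⟩ := hbd
    set B : Ordinal.{0} → Set Ordinal.{0} := fun ζ => {γ | ∃ y ∈ C γ, β ≤ y ∧ y < ζ} with hB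
    obtain ⟨α, ⟨hα, hβα⟩, hαB⟩ := ((ha.inter_Iio_ord).inter_Ioi hβ).exists_forall_lt_notMem hθ
      (B := B) (by
        intro ζ hζ hst
        obtain ⟨s, hs⟩ := hst.exists_traceSet hθ hC (fun γ hγ => hγ.1.1.1.1)
          (max_lt hξ hζ)
        obtain ⟨γ, ⟨⟨⟨⟨hγ, -⟩, -⟩, y, hy, hβy, hyζ⟩, hγs⟩, -⟩ := hs.nonempty
        have hs' : s = b (max ξ ζ) := huniq _ (le_max_left _ _) (max_lt hξ hζ) s
          (hs.mono fun γ hγ => hγ.2)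
          ((traceSet_subset (le_max_left _ _) s hγs).2.2.symm.trans hγ.2.2)
        have hyD : y ∈ D ∩ Iio (max ξ ζ) := by
          rw [hD _ (le_max_left _ _) (max_lt hξ hζ), ← hs', ← hγs.2.2]
          exact ⟨hy, lt_max_of_lt_right hyζ⟩
        exact (hbd y hyD.1).not_ge hβy)
    obtain ⟨y, hy, hβy⟩ := (hC.unbounded α hα.2 hα.1.1).2 β hβα
    have hyα : y < α := (hC.unbounded α hα.2 hα.1.1).1 hy
    exact hαB (y + 1) (by simpa using hα.1.1.succ_lt hyα)
      ⟨y, hy, hβy, Order.lt_add_one_iff.2 le_rfl⟩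
  · intro γ hγ hγθ
    set η := max ξ (γ + 1) with hη
    have hηθ : η < θ.ord := max_lt hξ (hsucc _ hγθ)
    have hlt : γ < η := lt_max_of_lt_right (Order.lt_add_one_iff.2 le_rfl)
    obtain ⟨β, h1, h2, h3, h4⟩ := hbC η (le_max_left _ _) hηθ
    have heq : D ∩ Iio η = C β ∩ Iio η := by rw [h4, hD η (le_max_left _ _) hηθ]
    have hγβ := mem_limitPts_of_inter_eq hlt.le heq hγ
    rw [hC.coherent β h1 h2 γ hγβ (hlt.trans h3), ← inter_Iio_inter_Iio D hlt.le, heq,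
      inter_Iio_inter_Iio _ hlt.le]

theorem exists_split_level (hθ : θ.IsRegular) (hC : IsSquareSeq θ.ord C)
    {ξ : Ordinal.{0}} (hξ : ξ < θ.ord) :
    ∃ η < θ.ord, ξ ≤ η ∧ ∀ a, Stat θ (traceSet C ξ a) →
      ∃ b b', Stat θ (traceSet C η b) ∧ Stat θ (traceSet C η b') ∧
        b ∩ Iio ξ = a ∧ b' ∩ Iio ξ = a ∧ b ≠ b' := by
  have h := fun a (ha : Stat θ (traceSet C ξ a)) => exists_split hθ hC hξ ha
  choose! f hf hξf hsplit using h
  classical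
  obtain ⟨η, hη, hfη⟩ := exists_bound hθ (mk_traces_lt hθ hC ξ hξ)
    (fun s => if Stat θ (traceSet C ξ s.1) then f s.1 else 0) (by
      intro s
      split_ifs with hs
      · exact hf s.1 hs
      · exact hθ.ord_pos)
  have hmax : max ξ η < θ.ord := max_lt hξ hη
  refine ⟨max ξ η, hmax, le_max_left _ _, fun a ha => ?_⟩
  obtain ⟨γ, ⟨h1, -, h2⟩, h3⟩ := ha.nonempty
  have hfa : f a < η := by
    have := hfη ⟨a, γ, h3, h1, h2.symm⟩
    simpa [ha] using this
  have hle : f a ≤ max ξ η := hfa.le.trans (le_max_right _ _)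
  obtain ⟨b, b', hb, hb', hba, hba', hne⟩ := hsplit a ha
  obtain ⟨c, hc, hcb⟩ := hb.exists_traceSet_extension hθ hC hle hmax
  obtain ⟨c', hc', hcb'⟩ := hb'.exists_traceSet_extension hθ hC hle hmax
  refine ⟨c, c', hc, hc', ?_, ?_, ?_⟩
  · rw [← hba, ← hcb, inter_Iio_inter_Iio _ (hξf a ha)]
  · rw [← hba', ← hcb', inter_Iio_inter_Iio _ (hξf a ha)]
  · rintro rfl
    exact hne (hcb.symm.trans hcb')

/-- The traces of a `□(θ)`-sequence below some level sort the indices into `δ` many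
stationary classes. -/
theorem exists_trace_rank (hθ : θ.IsRegular) (hθ' : ℵ₀ < θ) (hC : IsSquareSeq θ.ord C)
    {d : Ordinal.{0}} (hd : d < θ.ord) (hdlim : Order.IsSuccLimit d) :
    ∃ ξ < θ.ord, ∃ H : Set Ordinal.{0} → Ordinal.{0}, (∀ s, H s < d) ∧
      ∀ i < d, Stat θ {γ | Order.IsSuccLimit γ ∧ ξ < γ ∧ i < H (C γ ∩ Iio ξ)} := by
  have h := fun ξ (hξ : ξ < θ.ord) => exists_split_level hθ hC hξ
  choose! g hgθ hξg hsplit using h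
  obtain ⟨c, hc⟩ := exists_transfinite_seq (X := Ordinal.{0})
    (fun m F v => m < θ.ord → v < θ.ord ∧ ∀ l < m, g (F l) ≤ v)
    (fun β F F' v hFF' hQ hβ => ⟨(hQ hβ).1, fun l hl => hFF' l hl ▸ (hQ hβ).2 l hl⟩)
    (fun β F hF => by
      by_cases hβ : β < θ.ord
      · obtain ⟨v, hv, hvb⟩ := exists_bound_Iio hθ hβ (fun l => g (F l)) fun l hl =>
          hgθ _ (hF l hl (hl.trans hβ)).1
        exact ⟨v, fun _ => ⟨hv, fun l hl => (hvb l hl).le⟩⟩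
      · exact ⟨0, fun h => absurd h hβ⟩)
  have hcθ : ∀ m < θ.ord, c m < θ.ord := fun m hm => (hc m hm).1
  have hgc : ∀ m < θ.ord, ∀ l < m, g (c l) ≤ c m := fun m hm => (hc m hm).2
  have hcmono : ∀ m < θ.ord, ∀ l ≤ m, c l ≤ c m := fun m hm l hl => by
    rcases hl.eq_or_lt with rfl | hl
    · exact le_rfl
    · exact (hξg _ (hcθ l (hl.trans hm))).trans (hgc m hm l hl)
  obtain ⟨a, ha⟩ := (stat_isSuccLimit hθ hθ').exists_traceSet hθ hC (fun γ hγ => hγ) (hcθ d hd)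
  replace ha : Stat θ (traceSet C (c d) a) := ha.mono fun γ hγ => hγ.2
  have hd0 : 0 < d := hdlim.bot_lt
  let v : Set Ordinal.{0} → Ordinal.{0} := fun s => sInf {k | sInf (symmDiff s a) < c k}
  refine ⟨c d, hcθ d hd, fun s => if v s < d then v s else 0, fun s => ?_, fun i hi => ?_⟩
  · dsimp only
    split_ifs with hs
    · exact hs
    · exact hd0
  · have hiθ := hi.trans hd
    have hi1 : i + 1 < d := by simpa using hdlim.succ_lt hi
    have hgd : g (c i) ≤ c d := hgc d hd i hi
    have hig := hξg _ (hcθ i hiθ)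
    obtain ⟨b, hb, hba, hne⟩ : ∃ b, Stat θ (traceSet C (g (c i)) b) ∧ b ∩ Iio (c i) = a ∩ Iio (c i) ∧
        b ≠ a ∩ Iio (g (c i)) := by
      obtain ⟨b, b', h1, h2, h3, h4, h5⟩ := hsplit _ (hcθ i hiθ) (a ∩ Iio (c i))
        (ha.mono (traceSet_subset (hig.trans hgd) a))
      by_cases hb : b = a ∩ Iio (g (c i))
      · exact ⟨b', h2, h4, fun h => h5 (hb.trans h.symm)⟩
      · exact ⟨b, h1, h3, hb⟩
    refine (hb.inter_Ioi (hcθ d hd)).mono ?_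
    rintro γ ⟨⟨hγ, -, hγb⟩, hdγ⟩
    refine ⟨hγ, hdγ, ?_⟩
    set s := C γ ∩ Iio (c d) with hs
    have hsb : s ∩ Iio (g (c i)) = b := by rw [hs, inter_Iio_inter_Iio _ hgd, hγb]
    have hsi : s ∩ Iio (c i) = a ∩ Iio (c i) := by
      rw [← hba, ← hsb, inter_Iio_inter_Iio _ hig]
    have hlow : ∀ z ∈ symmDiff s a, c i ≤ z := by
      intro z hz
      by_contra! hzi
      have hiff : z ∈ s ↔ z ∈ a := by
        have := Set.ext_iff.1 hsi z
        simpa [hzi] using this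
      rcases hz with hz | hz
      · exact hz.2 (hiff.1 hz.1)
      · exact hz.2 (hiff.2 hz.1)
    obtain ⟨z, hz, hzg⟩ : ∃ z ∈ symmDiff s a, z < g (c i) := by
      by_contra! hno
      refine hne (hsb.symm.trans (Set.ext fun z => ?_))
      simp only [mem_inter_iff, mem_Iio, and_congr_left_iff]
      intro hzg
      by_contra hz
      refine (hno z ?_).not_gt hzg
      rw [Set.mem_symmDiff]
      tauto
    have hmem : symmDiff s a |>.Nonempty := ⟨z, hz⟩
    have h1 : c i ≤ sInf (symmDiff s a) := le_csInf hmem hlow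
    have h2 : sInf (symmDiff s a) < g (c i) := (csInf_le' hz).trans_lt hzg
    have h3 : i + 1 ∈ {k | sInf (symmDiff s a) < c k} :=
      h2.trans_le (hgc _ (hi1.trans hd) i (Order.lt_add_one_iff.2 le_rfl))
    have hvlt : v s < d := (csInf_le' h3).trans_lt hi1
    have hiv : i < v s := by
      by_contra! hvi
      have h4 : sInf (symmDiff s a) < c (v s) := csInf_mem (s := {k | _ < c k}) ⟨_, h3⟩
      exact (h4.trans_le (hcmono i hiθ _ hvi)).not_ge h1
    simpa [hvlt] using hiv

end Combinatorics

section Measure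

theorem IsNormalUltrafilter.iInter_mem (hU : IsNormalUltrafilter δ U) {ι : Type} [Countable ι]
    {t : ι → Set (Idx δ)} (ht : ∀ j, t j ∈ U) : (⋂ j, t j) ∈ U :=
  hU.complete ι t (Cardinal.mk_le_aleph0.trans_lt hU.uncountable) ht

theorem IsNormalUltrafilter.tail_mem (hU : IsNormalUltrafilter δ U) {h : Ordinal.{0}}
    (hh : h < δ.ord) : {i : Idx δ | h ≤ i.1} ∈ U := by
  have := hU.complete h.ToType
    (fun j => {i | i.1 ≠ (Ordinal.ToType.mk.symm j : Iio h).1}) (by simpa using Cardinal.lt_ord.1 hh)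
    (fun j => by
      have hj := (Ordinal.ToType.mk.symm j).2
      have : {i : Idx δ | i.1 ≠ (Ordinal.ToType.mk.symm j : Iio h).1} =
          ({⟨_, lt_trans (mem_Iio.1 hj) hh⟩} : Set (Idx δ))ᶜ := by
        ext i
        simp [Subtype.ext_iff]
      rw [this]
      exact Ultrafilter.compl_mem_iff_notMem.2 (hU.nonprincipal _))
  refine Filter.mem_of_superset this fun i hi => ?_
  by_contra hlt
  have hlt : i.1 < h := not_le.1 hlt
  exact mem_iInter.1 hi (Ordinal.ToType.mk ⟨i.1, hlt⟩) (by simp)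

end Measure

section Glue

theorem iUnion_inter_Iio_of_coherent {E : Set Ordinal.{0}} {G : Ordinal.{0} → Set Ordinal.{0}}
    (hsub : ∀ γ ∈ E, G γ ⊆ Iio γ)
    (hG : ∀ γ ∈ E, ∀ γ' ∈ E, γ < γ' → G γ = G γ' ∩ Iio γ) {γ : Ordinal.{0}} (hγ : γ ∈ E) :
    (⋃ γ' ∈ E, G γ') ∩ Iio γ = G γ := by
  ext x
  simp only [mem_inter_iff, mem_iUnion, mem_Iio, exists_prop]
  constructor
  · rintro ⟨⟨γ', hγ', hx⟩, hxγ⟩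
    rcases lt_trichotomy γ γ' with h | rfl | h
    · rw [hG γ hγ γ' hγ' h]
      exact ⟨hx, hxγ⟩
    · exact hx
    · rw [hG γ' hγ' γ hγ h] at hx
      exact hx.1
  · exact fun hx => ⟨⟨γ, hγ, hx⟩, hsub γ hγ hx⟩

theorem le_of_mem_limitPts {A : Set Ordinal.{0}} {α β : Ordinal.{0}} (hA : A ⊆ Iio β)
    (hα : α ∈ limitPts A) : α ≤ β := by
  by_contra! h
  obtain ⟨y, hy, h1, -⟩ := (mem_limitPts_iff.1 hα).2 β h
  exact h1.not_gt (hA hy)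

theorem mem_limitPts_of_limitPts {A : Set Ordinal.{0}} {s : Ordinal.{0}} (h0 : s ≠ 0)
    (h : ∀ x < s, ∃ y ∈ limitPts A, x < y ∧ y ≤ s) : s ∈ limitPts A := by
  refine mem_limitPts_iff.2 ⟨h0, fun x hx => ?_⟩
  obtain ⟨y, hy, hxy, hys⟩ := h x hx
  obtain ⟨z, hz, hxz, hzy⟩ := (mem_limitPts_iff.1 hy).2 x hxy
  exact ⟨z, hz, hxz, hzy.trans_le hys⟩

/-- If the limit points of an unbounded subset of a limit ordinal are bounded below it, the
ordinal has countable cofinality. -/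
theorem exists_cofinal_seq {A : Set Ordinal.{0}} {β γ : Ordinal.{0}} (hA : UnbSub A β)
    (hβ : Order.IsSuccLimit β) (hγβ : γ < β) (hγ : ∀ α ∈ limitPts A, α < β → α ≤ γ) :
    ∃ e : ℕ → Ordinal.{0}, e 0 = γ ∧ (∀ n, e n < β) ∧ ∀ x < β, ∃ n, x < e n := by
  have hnext : ∀ x < β, ∃ y ∈ A, x < y := fun x hx => by
    obtain ⟨y, hy, h⟩ := hA.2 (x + 1) (by simpa using hβ.succ_lt hx)
    exact ⟨y, hy, (Order.lt_add_one_iff.2 le_rfl).trans_le h⟩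
  choose! s hsA hs using hnext
  let e : ℕ → Ordinal.{0} := fun n => s^[n] γ
  have he : ∀ n, e (n + 1) = s (e n) := fun n => Function.iterate_succ_apply' s n γ
  have heβ : ∀ n, e n < β := by
    intro n
    induction n with
    | zero => exact hγβ
    | succ n ih => rw [he]; exact hA.1 (hsA _ ih)
  refine ⟨e, rfl, heβ, fun x hx => ?_⟩
  by_contra! hcon
  have hlt : ∀ n, e n < ⨆ n, e n := fun n =>
    ((hs _ (heβ n)).trans_eq (he n).symm).trans_le (Ordinal.le_iSup e (n + 1))
  refine (hγ (⨆ n, e n) (mem_limitPts_iff.2 ⟨(bot_le.trans_lt (hlt 0)).ne', fun y hy => ?_⟩)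
    ((Ordinal.iSup_le hcon).trans_lt hx)).not_gt (hlt 0)
  obtain ⟨n, hn⟩ := Ordinal.lt_iSup_iff.1 hy
  exact ⟨e (n + 1), he n ▸ hsA _ (heβ n),
    hn.trans ((hs _ (heβ n)).trans_eq (he n).symm), hlt (n + 1)⟩

end Glue

section Recursion

variable {ξ : Ordinal.{0}} {h : Ordinal.{0} → Ordinal.{0}} {C : Ordinal.{0} → Set Ordinal.{0}}

/-- The requirements on the value `v` at `β` of a sequence `F` of functions representing sets
in the ultrapower: `v` end-extends the earlier values modulo `U`, exactly so along the limit
points of `C β` at large indices, and at the index `i` it has only limit points `α` with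
`h α ≤ i`. -/
structure IsStep (U : Ultrafilter (Idx δ)) (ξ : Ordinal.{0}) (h : Ordinal.{0} → Ordinal.{0})
    (C : Ordinal.{0} → Set Ordinal.{0}) (β : Ordinal.{0})
    (F : Ordinal.{0} → Idx δ → Set Ordinal.{0}) (v : Idx δ → Set Ordinal.{0}) : Prop where
  subset : ∀ i, v i ⊆ Iio β
  coherent : ∀ γ < β, {i | F γ i = v i ∩ Iio γ} ∈ U
  thread : ξ < β → Order.IsSuccLimit β → ∀ γ ∈ limitPts (C β), ξ < γ → γ < β →
    ∀ i, h β ≤ i.1 → F γ i = v i ∩ Iio γ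
  limit : ∀ i, ∀ α ∈ limitPts (v i), ξ < α → h α ≤ i.1
  succ : ∀ γ, ξ ≤ γ → β = γ + 1 → ∀ i, γ ∈ v i
  empty : β ≤ ξ → ∀ i, v i = ∅

theorem IsStep.congr {β : Ordinal.{0}} {F F' : Ordinal.{0} → Idx δ → Set Ordinal.{0}}
    {v : Idx δ → Set Ordinal.{0}} (hF : ∀ γ < β, F γ = F' γ) (hv : IsStep U ξ h C β F v) :
    IsStep U ξ h C β F' v where
  subset := hv.subset
  coherent γ hγ := by
    rw [← hF γ hγ]
    exact hv.coherent γ hγ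
  thread h1 h2 γ h3 h4 h5 := by
    rw [← hF γ h5]
    exact hv.thread h1 h2 γ h3 h4 h5
  limit := hv.limit
  succ := hv.succ
  empty := hv.empty

theorem limitPts_empty : limitPts ∅ = ∅ := by
  ext b
  simp [limitPts]

theorem isStep_of_le {β : Ordinal.{0}} (hβ : β ≤ ξ) {F : Ordinal.{0} → Idx δ → Set Ordinal.{0}}
    (hF : ∀ γ < β, IsStep U ξ h C γ F (F γ)) : IsStep U ξ h C β F fun _ => ∅ where
  subset _ := empty_subset _
  coherent γ hγ := by
    refine Filter.univ_mem' fun i => ?_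
    simp [(hF γ hγ).empty (hγ.le.trans hβ) i]
  thread h1 := absurd hβ h1.not_ge
  limit i α hα := by simp [limitPts_empty] at hα
  succ γ h1 h2 := by
    rw [h2] at hβ
    exact absurd (h1.trans_lt (Order.lt_add_one_iff.2 le_rfl)) hβ.not_gt
  empty _ _ := rfl

theorem isStep_add_one {β : Ordinal.{0}} (hβ : ξ ≤ β) {F : Ordinal.{0} → Idx δ → Set Ordinal.{0}}
    (hF : IsStep U ξ h C β F (F β)) :
    IsStep U ξ h C (β + 1) F fun i => insert β (F β i) := by
  have hres : ∀ i, ∀ γ ≤ β, insert β (F β i) ∩ Iio γ = F β i ∩ Iio γ := by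
    intro i γ hγ
    rw [insert_inter_of_notMem]
    exact hγ.not_gt
  have hlt : β < β + 1 := Order.lt_add_one_iff.2 le_rfl
  refine ⟨fun i x hx => ?_, fun γ hγ => ?_, fun _ h2 => ?_, fun i α hα hξ => ?_, ?_, fun hle => ?_⟩
  · rcases hx with rfl | hx
    · exact hlt
    · exact lt_trans (hF.subset i hx) hlt
  · have hγ := Order.lt_add_one_iff.1 hγ
    simp only [hres _ _ hγ]
    rcases hγ.eq_or_lt with rfl | hγ
    · exact Filter.univ_mem' fun i => (inter_eq_left.2 (hF.subset i)).symm
    · exact hF.coherent γ hγ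
  · rw [← Order.succ_eq_add_one] at h2
    exact absurd h2 (Order.not_isSuccLimit_succ β)
  · have hαβ : α ≤ β := by
      by_contra! hlt
      obtain ⟨y, hy, h1, h2⟩ := (mem_limitPts_iff.1 hα).2 β hlt
      rcases hy with rfl | hy
      · exact h1.false
      · exact h1.not_gt (hF.subset i hy)
    exact hF.limit i α (mem_limitPts_of_inter_eq hαβ (hres i β le_rfl) hα) hξ
  · intro γ _ hγ i
    have : β = γ := by simpa using hγ
    exact this ▸ mem_insert _ _
  · exact absurd (hβ.trans_lt hlt) hle.not_gt

/-- The values of `F` at the index `i` end-extend each other along `E`. -/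
def CoheresOn (F : Ordinal.{0} → Idx δ → Set Ordinal.{0}) (E : Set Ordinal.{0}) (i : Idx δ) :
    Prop :=
  ∀ γ ∈ E, ∀ γ' ∈ E, γ < γ' → F γ i = F γ' i ∩ Iio γ

/-- The limit case: glue the values along a set `E` cofinal in `β` at those indices where they
cohere, and use the value at `ρ` at the remaining ones. -/
theorem isStep_limit {β : Ordinal.{0}} (hβ : Order.IsSuccLimit β) (hξβ : ξ < β)
    {F : Ordinal.{0} → Idx δ → Set Ordinal.{0}} (hF : ∀ γ < β, IsStep U ξ h C γ F (F γ))
    (htail : {i : Idx δ | h β ≤ i.1} ∈ U) {E : Set Ordinal.{0}} (hE : E ⊆ Iio β)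
    (hEub : ∀ x < β, ∃ γ ∈ E, x < γ) (hgood : {i | h β ≤ i.1 → CoheresOn F E i} ∈ U)
    {ρ : Ordinal.{0}} (hρ : ρ ∈ E)
    (hthread : ∀ γ ∈ limitPts (C β), ξ < γ → γ < β → ∀ i : Idx δ, h β ≤ i.1 →
      ∃ γ' ∈ E, γ ≤ γ' ∧ F γ i = F γ' i ∩ Iio γ ∧ (CoheresOn F E i ∨ γ' = ρ)) :
    ∃ v, IsStep U ξ h C β F v := by
  classical
  have hres : ∀ i, CoheresOn F E i → ∀ γ ∈ E, (⋃ γ' ∈ E, F γ' i) ∩ Iio γ = F γ i :=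
    fun i hi γ hγ => iUnion_inter_Iio_of_coherent (G := fun γ => F γ i)
      (fun γ hγ => (hF γ (hE hγ)).subset i) hi hγ
  have hUsub : ∀ i, (⋃ γ' ∈ E, F γ' i) ⊆ Iio β := fun i => iUnion₂_subset fun γ hγ =>
    ((hF γ (hE hγ)).subset i).trans (Iio_subset_Iio (le_of_lt (hE hγ)))
  have hsubF : ∀ i, ∀ γ < β, F γ i ⊆ Iio β := fun i γ hγ =>
    ((hF γ hγ).subset i).trans (Iio_subset_Iio hγ.le)
  let v : Idx δ → Set Ordinal.{0} := fun i =>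
    if h β ≤ i.1 then if CoheresOn F E i then ⋃ γ ∈ E, F γ i else F ρ i else ∅
  have hv1 : ∀ i : Idx δ, h β ≤ i.1 → CoheresOn F E i → v i = ⋃ γ ∈ E, F γ i :=
    fun i h1 h2 => by simp only [v, if_pos h1, if_pos h2]
  have hv2 : ∀ i : Idx δ, h β ≤ i.1 → ¬ CoheresOn F E i → v i = F ρ i :=
    fun i h1 h2 => by simp only [v, if_pos h1, if_neg h2]
  have hv3 : ∀ i : Idx δ, ¬ h β ≤ i.1 → v i = ∅ := fun i h1 => by simp only [v, if_neg h1]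
  refine ⟨v, ?_, ?_, ?_, ?_, ?_, ?_⟩
  · intro i
    by_cases h1 : h β ≤ i.1
    · by_cases h2 : CoheresOn F E i
      · rw [hv1 i h1 h2]
        exact hUsub i
      · rw [hv2 i h1 h2]
        exact hsubF i ρ (hE hρ)
    · rw [hv3 i h1]
      exact empty_subset _
  · intro γ hγ
    obtain ⟨γ', hγ', hlt⟩ := hEub γ hγ
    filter_upwards [htail, hgood, (hF γ' (hE hγ')).coherent γ hlt] with i h1 h2 h3
    rw [h3, hv1 i h1 (h2 h1), ← hres i (h2 h1) γ' hγ', inter_Iio_inter_Iio _ hlt.le]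
  · intro _ _ γ hγ hξγ hγβ i h1
    obtain ⟨γ', hγ', hle, heq, h2⟩ := hthread γ hγ hξγ hγβ i h1
    by_cases h3 : CoheresOn F E i
    · rw [heq, hv1 i h1 h3, ← hres i h3 γ' hγ', inter_Iio_inter_Iio _ hle]
    · rw [hv2 i h1 h3, heq, h2.resolve_left h3]
  · intro i α hα hξα
    by_cases h1 : h β ≤ i.1
    · by_cases h2 : CoheresOn F E i
      · rw [hv1 i h1 h2] at hα
        rcases (le_of_mem_limitPts (hUsub i) hα).eq_or_lt with rfl | hlt
        · exact h1
        · obtain ⟨γ, hγ, hαγ⟩ := hEub α hlt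
          refine (hF γ (hE hγ)).limit i α (mem_limitPts_of_inter_eq hαγ.le ?_ hα) hξα
          rw [hres i h2 γ hγ, inter_eq_left.2 ((hF γ (hE hγ)).subset i)]
      · rw [hv2 i h1 h2] at hα
        exact (hF ρ (hE hρ)).limit i α hα hξα
    · rw [hv3 i h1, limitPts_empty] at hα
      exact absurd hα (notMem_empty α)
  · intro γ _ hγ
    rw [hγ, ← Order.succ_eq_add_one] at hβ
    exact absurd hβ (Order.not_isSuccLimit_succ γ)
  · exact fun hle => absurd hξβ hle.not_gt

theorem exists_isStep_limit (hU : IsNormalUltrafilter δ U) {Θ : Ordinal.{0}}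
    (hC : IsSquareSeq Θ C) (hh : ∀ β, h β < δ.ord)
    (hhC : ∀ β < Θ, Order.IsSuccLimit β → ∀ γ ∈ limitPts (C β), ξ < γ → γ < β → h γ = h β)
    {β : Ordinal.{0}} (hβΘ : β < Θ) (hβ : Order.IsSuccLimit β) (hξβ : ξ < β)
    {F : Ordinal.{0} → Idx δ → Set Ordinal.{0}} (hF : ∀ γ < β, IsStep U ξ h C γ F (F γ)) :
    ∃ v, IsStep U ξ h C β F v := by
  have htail := hU.tail_mem (hh β)
  have hcoh : ∀ γ ∈ limitPts (C β), ∀ γ' ∈ limitPts (C β), ξ < γ → γ < γ' → γ' < β →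
      ∀ i : Idx δ, h β ≤ i.1 → F γ i = F γ' i ∩ Iio γ := by
    intro γ hγ γ' hγ' hξγ hlt hγ'β i hi
    have hξγ' := hξγ.trans hlt
    have hCγ' := hC.coherent β hβΘ hβ γ' hγ' hγ'β
    refine (hF γ' hγ'β).thread hξγ' (isSuccLimit_of_mem_limitPts hγ') γ ?_ hξγ hlt i
      ((hhC β hβΘ hβ γ' hγ' hξγ' hγ'β).trans_le hi)
    refine mem_limitPts_of_inter_eq hlt.le ?_ hγ
    rw [hCγ', inter_Iio_inter_Iio _ le_rfl]
  by_cases hub : ∀ x < β, ∃ γ ∈ limitPts (C β), x < γ ∧ γ < β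
  · obtain ⟨ρ, hρ, hξρ, hρβ⟩ := hub ξ hξβ
    have hgood : ∀ i : Idx δ, h β ≤ i.1 → CoheresOn F (limitPts (C β) ∩ Ioo ξ β) i :=
      fun i hi γ hγ γ' hγ' hlt => hcoh γ hγ.1 γ' hγ'.1 hγ.2.1 hlt hγ'.2.2 i hi
    refine isStep_limit hβ hξβ hF htail (E := limitPts (C β) ∩ Ioo ξ β) (fun γ hγ => hγ.2.2) ?_
      (Filter.univ_mem' hgood) ⟨hρ, hξρ, hρβ⟩ ?_
    · intro x hx
      obtain ⟨γ, hγ, hlt, hγβ⟩ := hub _ (max_lt hx hξβ)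
      exact ⟨γ, ⟨hγ, (le_max_right _ _).trans_lt hlt, hγβ⟩, (le_max_left _ _).trans_lt hlt⟩
    · exact fun γ hγ hξγ hγβ i hi => ⟨γ, ⟨hγ, hξγ, hγβ⟩, le_rfl,
        (inter_eq_left.2 ((hF γ hγβ).subset i)).symm, Or.inl (hgood i hi)⟩
  · push Not at hub
    obtain ⟨x, hx, hbd⟩ := hub
    obtain ⟨ρ, hξρ, hρβ, hρ, hρmax⟩ : ∃ ρ, ξ ≤ ρ ∧ ρ < β ∧ (ξ < ρ → ρ ∈ limitPts (C β)) ∧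
        ∀ γ ∈ limitPts (C β), γ < β → γ ≤ ρ := by
      have hbdd : BddAbove (limitPts (C β) ∩ Ioo ξ β) := ⟨β, fun γ hγ => hγ.2.2.le⟩
      rcases (limitPts (C β) ∩ Ioo ξ β).eq_empty_or_nonempty with he | hne
      · refine ⟨ξ, le_rfl, hξβ, fun hlt => absurd hlt (lt_irrefl ξ), fun γ hγ hγβ => ?_⟩
        by_contra! hlt
        exact notMem_empty γ (he ▸ ⟨hγ, hlt, hγβ⟩)
      · obtain ⟨γ, hγ⟩ := id hne
        have hξs : ξ < sSup (limitPts (C β) ∩ Ioo ξ β) := hγ.2.1.trans_le (le_csSup hbdd hγ)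
        refine ⟨_, hξs.le, (csSup_le hne fun γ hγ => ?_).trans_lt hx, fun _ => ?_,
          fun γ hγ hγβ => ?_⟩
        · by_contra! hlt
          exact (hbd γ hγ.1 hlt).not_gt hγ.2.2
        · refine mem_limitPts_of_limitPts (bot_le.trans_lt hξs).ne' fun y hy => ?_
          obtain ⟨z, hz, hyz⟩ := exists_lt_of_lt_csSup hne hy
          exact ⟨z, hz.1, hyz, le_csSup hbdd hz⟩
        · rcases le_or_gt γ ξ with hle | hlt
          · exact hle.trans hξs.le
          · exact le_csSup hbdd ⟨hγ, hlt, hγβ⟩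
    obtain ⟨e, he0, heβ, hecof⟩ := exists_cofinal_seq (hC.unbounded β hβΘ hβ) hβ hρβ hρmax
    refine isStep_limit hβ hξβ hF htail (E := range e) (range_subset_iff.2 heβ) ?_ ?_
      (ρ := ρ) ⟨0, he0⟩ ?_
    · intro y hy
      obtain ⟨n, hn⟩ := hecof y hy
      exact ⟨e n, mem_range_self n, hn⟩
    · have hp : ∀ p : ℕ × ℕ, {i | e p.1 < e p.2 → F (e p.1) i = F (e p.2) i ∩ Iio (e p.1)} ∈ U := by
        intro p
        by_cases hlt : e p.1 < e p.2
        · filter_upwards [(hF _ (heβ p.2)).coherent _ hlt] with i hi _ using hi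
        · exact Filter.univ_mem' fun i h => absurd h hlt
      refine Filter.mem_of_superset (hU.iInter_mem hp) fun i hi _ => ?_
      rintro _ ⟨m, rfl⟩ _ ⟨n, rfl⟩
      exact mem_iInter.1 hi (m, n)
    · intro γ hγ hξγ hγβ i hi
      refine ⟨ρ, ⟨0, he0⟩, hρmax γ hγ hγβ, ?_, Or.inr rfl⟩
      rcases (hρmax γ hγ hγβ).eq_or_lt with rfl | hlt
      · exact (inter_eq_left.2 ((hF γ hγβ).subset i)).symm
      · exact hcoh γ hγ ρ (hρ (hξγ.trans hlt)) hξγ hlt hρβ i hi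

theorem exists_isStep_seq (hU : IsNormalUltrafilter δ U) {Θ : Ordinal.{0}}
    (hC : IsSquareSeq Θ C) (hh : ∀ β, h β < δ.ord)
    (hhC : ∀ β < Θ, Order.IsSuccLimit β → ∀ γ ∈ limitPts (C β), ξ < γ → γ < β → h γ = h β) :
    ∃ F, ∀ β < Θ, IsStep U ξ h C β F (F β) := by
  refine exists_transfinite_seq (X := Idx δ → Set Ordinal.{0})
    (fun β F v => β < Θ → IsStep U ξ h C β F v)
    (fun β F F' v hFF' hQ hβ => (hQ hβ).congr hFF') fun β F hF => ?_
  by_cases hβΘ : β < Θ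
  swap
  · exact ⟨fun _ => ∅, fun h => absurd h hβΘ⟩
  replace hF : ∀ γ < β, IsStep U ξ h C γ F (F γ) := fun γ hγ => hF γ hγ (hγ.trans hβΘ)
  suffices ∃ v, IsStep U ξ h C β F v from this.imp fun v hv _ => hv
  rcases le_or_gt β ξ with hβξ | hξβ
  · exact ⟨_, isStep_of_le hβξ hF⟩
  rcases Ordinal.zero_or_succ_or_isSuccLimit β with rfl | ⟨γ, rfl⟩ | hβ
  · exact absurd hξβ (by simp)
  · have hγ : γ < γ + 1 := Order.lt_add_one_iff.2 le_rfl
    exact ⟨_, isStep_add_one (Order.lt_add_one_iff.1 hξβ) (hF γ hγ)⟩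
  · exact exists_isStep_limit hU hC hh hhC hβΘ hβ hξβ hF

end Recursion

section Ultrapower

instance : Small.{0} (Idx δ) := inferInstanceAs (Small.{0} (Iio δ.ord))

variable (hU : IsNormalUltrafilter δ U)
include hU

theorem ultLT.rank_lt {f g : Idx δ → Ordinal.{0}} (h : ultLT U f g) :
    ((ultLT_wf hU).apply f).rank < ((ultLT_wf hU).apply g).rank :=
  Acc.rank_lt_of_rel ((ultLT_wf hU).apply g) h

theorem rank_le_of_eventuallyEq {f g : Idx δ → Ordinal.{0}} (h : {i | f i = g i} ∈ U) :
    ((ultLT_wf hU).apply f).rank ≤ ((ultLT_wf hU).apply g).rank := by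
  rw [Acc.rank_eq]
  refine ciSup_le' fun b => Order.succ_le_of_lt (ultLT.rank_lt hU ?_)
  filter_upwards [h, b.2] with i h1 h2 using h2.trans_eq h1

theorem rank_eq_of_eventuallyEq {f g : Idx δ → Ordinal.{0}} (h : {i | f i = g i} ∈ U) :
    ((ultLT_wf hU).apply f).rank = ((ultLT_wf hU).apply g).rank :=
  le_antisymm (rank_le_of_eventuallyEq hU h)
    (rank_le_of_eventuallyEq hU (Filter.mem_of_superset h fun _ hi => Eq.symm hi))

theorem exists_lift_eq_rank (f : Idx δ → Ordinal.{0}) :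
    ∃ o : Ordinal.{0}, Ordinal.lift.{1} o = ((ultLT_wf hU).apply f).rank := by
  classical
  induction f using (ultLT_wf hU).induction with
  | h f ih =>
    obtain ⟨B, hB⟩ := Ordinal.bddAbove_of_small (s := range f)
    have hB : ∀ i, f i < B + 1 := fun i => Order.lt_add_one_iff.2 (hB (mem_range_self i))
    let T := {t : Idx δ → Iio (B + 1) // ultLT U (fun i => (t i).1) f}
    choose o ho using fun t : T => ih _ t.2
    have hbdd : BddAbove (range fun t => o t + 1) := Ordinal.bddAbove_of_small
    refine Ordinal.mem_range_lift_of_le (a := ⨆ t, (o t + 1)) ?_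
    rw [Acc.rank_eq]
    refine ciSup_le' fun b => ?_
    have hb : {i | b.1 i < f i} ∈ U := b.2
    let t : Idx δ → Iio (B + 1) := fun i =>
      if h : b.1 i < B + 1 then ⟨b.1 i, h⟩ else ⟨0, bot_le.trans_lt (hB i)⟩
    have ht : {i | b.1 i = (t i).1} ∈ U := by
      filter_upwards [hb] with i hi
      have : b.1 i < B + 1 := hi.trans (hB i)
      simp only [t, dif_pos this]
    have htf : ultLT U (fun i => (t i).1) f := by
      filter_upwards [hb, ht] with i h1 h2 using h2.symm.trans_lt h1
    have h1 := (ho ⟨t, htf⟩).trans (rank_eq_of_eventuallyEq hU ht).symm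
    rw [← h1, ← Ordinal.lift_succ, Ordinal.lift_le, Order.succ_eq_add_one]
    exact le_ciSup hbdd ⟨t, htf⟩

theorem lift_ordRank (f : Idx δ → Ordinal.{0}) :
    Ordinal.lift.{1} (ordRank hU f) = ((ultLT_wf hU).apply f).rank :=
  csInf_mem (s := {o : Ordinal.{0} | Ordinal.lift.{1} o = _}) (exists_lift_eq_rank hU f)

theorem ordRank_eq_of_eventuallyEq {f g : Idx δ → Ordinal.{0}} (h : {i | f i = g i} ∈ U) :
    ordRank hU f = ordRank hU g := by
  rw [← Ordinal.lift_inj.{1, 0}, lift_ordRank, lift_ordRank, rank_eq_of_eventuallyEq hU h]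

theorem ordRank_lt_of_ultLT {f g : Idx δ → Ordinal.{0}} (h : ultLT U f g) :
    ordRank hU f < ordRank hU g := by
  rw [← Ordinal.lift_lt.{1, 0}, lift_ordRank, lift_ordRank]
  exact h.rank_lt hU

omit hU in
theorem ultLT_trichotomy (f g : Idx δ → Ordinal.{0}) :
    ultLT U f g ∨ {i | f i = g i} ∈ U ∨ ultLT U g f := by
  simp only [ultLT, ← Ultrafilter.union_mem_iff]
  exact Filter.univ_mem' fun i => lt_trichotomy (f i) (g i)

theorem ordRank_lt_ordRank {f g : Idx δ → Ordinal.{0}} :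
    ordRank hU f < ordRank hU g ↔ ultLT U f g := by
  refine ⟨fun h => ?_, ordRank_lt_of_ultLT hU⟩
  rcases ultLT_trichotomy (U := U) f g with h1 | h1 | h1
  · exact h1
  · exact absurd (ordRank_eq_of_eventuallyEq hU h1) h.ne
  · exact absurd (ordRank_lt_of_ultLT hU h1) h.not_gt

theorem ordRank_eq_ordRank {f g : Idx δ → Ordinal.{0}} :
    ordRank hU f = ordRank hU g ↔ {i | f i = g i} ∈ U := by
  refine ⟨fun h => ?_, ordRank_eq_of_eventuallyEq hU⟩
  rcases ultLT_trichotomy (U := U) f g with h1 | h1 | h1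
  · exact absurd h (ordRank_lt_of_ultLT hU h1).ne
  · exact h1
  · exact absurd h (ordRank_lt_of_ultLT hU h1).ne'

theorem exists_ordRank_eq_of_lt {f : Idx δ → Ordinal.{0}} {o : Ordinal.{0}}
    (ho : o < ordRank hU f) : ∃ g, ultLT U g f ∧ ordRank hU g = o := by
  have h : Ordinal.lift.{1} o ≤ ((ultLT_wf hU).apply f).rank := by
    rw [← lift_ordRank, Ordinal.lift_le]
    exact ho.le
  obtain ⟨g, _, hg⟩ := Acc.mem_range_rank_of_le _ h
  have hgo : ordRank hU g = o := by
    rw [← Ordinal.lift_inj.{1, 0}, lift_ordRank]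
    exact hg
  exact ⟨g, (ordRank_lt_ordRank hU).1 (hgo.trans_lt ho), hgo⟩

theorem ordRank_mem_ultSet {g : Idx δ → Ordinal.{0}} {f : Idx δ → Set Ordinal.{0}} :
    ordRank hU g ∈ ultSet hU f ↔ {i | g i ∈ f i} ∈ U := by
  refine ⟨?_, fun h => ⟨g, h, rfl⟩⟩
  rintro ⟨g', h, heq⟩
  filter_upwards [h, (ordRank_eq_ordRank hU).1 heq] with i h1 h2
  exact h2 ▸ h1

theorem jU_strictMono : StrictMono (jU hU) := fun _ _ h =>
  ordRank_lt_of_ultLT hU (Filter.univ_mem' fun _ => h)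

omit hU in
theorem mk_Idx_lt {θ : Cardinal.{0}} (hδθ : δ < θ) : #(Idx δ) < Cardinal.lift.{1} θ :=
  mk_Iio_lt_lift (Cardinal.ord_lt_ord.2 hδθ)

variable {θ : Cardinal.{0}} (hθ : θ.IsRegular) (hδθ : δ < θ)
include hθ hδθ

/-- `j_U` is continuous at regular cardinals above `δ`. -/
theorem exists_eq_ordRank_of_lt_jU {o : Ordinal.{0}} (ho : o < jU hU θ.ord) :
    ∃ g, ordRank hU g = o ∧ ∃ β < θ.ord, {i | g i < β} ∈ U := by
  classical
  obtain ⟨g, hg, rfl⟩ := exists_ordRank_eq_of_lt hU ho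
  obtain ⟨β, hβ, h⟩ := exists_bound hθ (mk_Idx_lt hδθ)
    (fun i => if g i < θ.ord then g i else 0) fun i => by
      split_ifs with hi
      · exact hi
      · exact hθ.ord_pos
  refine ⟨g, rfl, β, hβ, ?_⟩
  filter_upwards [hg] with i hi
  simpa [show g i < θ.ord from hi] using h i

theorem jU_ord_eq_iSup : jU hU θ.ord = ⨆ β : Iio θ.ord, (jU hU β + 1) := by
  have hle : ∀ β : Iio θ.ord, jU hU β + 1 ≤ jU hU θ.ord := fun β =>
    Order.add_one_le_of_lt (jU_strictMono hU β.2)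
  refine le_antisymm (le_of_forall_lt fun o ho => ?_) (ciSup_le' hle)
  obtain ⟨g, rfl, β, hβ, hg⟩ := exists_eq_ordRank_of_lt_jU hU hθ hδθ ho
  refine (ordRank_lt_of_ultLT hU hg).trans_le ((Order.lt_add_one_iff.2 le_rfl).le.trans
    (le_ciSup (f := fun β : Iio θ.ord => jU hU β + 1) ?_ ⟨β, hβ⟩))
  exact ⟨_, forall_mem_range.2 hle⟩

theorem cof_jU_ord : (jU hU θ.ord).cof = θ := by
  rw [jU_ord_eq_iSup hU hθ hδθ,
    Ordinal.cof_iSup_Iio_add_one (f := fun β : Iio θ.ord => jU hU β)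
      ((jU_strictMono hU).comp (Subtype.strictMono_coe _)), hθ.cof_ord]

end Ultrapower

section FreshSet

variable {θ : Cardinal.{0}} {ξ : Ordinal.{0}} {h : Ordinal.{0} → Ordinal.{0}}
  {C : Ordinal.{0} → Set Ordinal.{0}} {F : Ordinal.{0} → Idx δ → Set Ordinal.{0}}

/-- The union of the sets in the ultrapower represented by the functions `F β`. -/
def ultUnion (hU : IsNormalUltrafilter δ U) (Θ : Ordinal.{0})
    (F : Ordinal.{0} → Idx δ → Set Ordinal.{0}) : Set Ordinal.{0} :=
  {o | ∃ β < Θ, o ∈ ultSet hU (F β)}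

theorem ordRank_mem_ultUnion (hU : IsNormalUltrafilter δ U) {Θ : Ordinal.{0}}
    (hF : ∀ β < Θ, IsStep U ξ h C β F (F β))
    {β : Ordinal.{0}} (hβ : β < Θ) {g : Idx δ → Ordinal.{0}} (hg : {i | g i < β} ∈ U) :
    ordRank hU g ∈ ultUnion hU Θ F ↔ {i | g i ∈ F β i} ∈ U := by
  refine ⟨?_, fun hg => ⟨β, hβ, (ordRank_mem_ultSet hU).2 hg⟩⟩
  rintro ⟨γ, hγ, hgγ⟩
  rw [ordRank_mem_ultSet] at hgγ
  rcases lt_trichotomy β γ with hlt | rfl | hlt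
  · filter_upwards [hg, hgγ, (hF γ hγ).coherent β hlt] with i h1 h2 h3
    rw [h3]
    exact ⟨h2, h1⟩
  · exact hgγ
  · filter_upwards [hgγ, (hF β hβ).coherent γ hlt] with i h1 h2
    rw [h2] at h1
    exact h1.1

theorem ultUnion_subset (hU : IsNormalUltrafilter δ U) {Θ : Ordinal.{0}}
    (hF : ∀ β < Θ, IsStep U ξ h C β F (F β)) : ultUnion hU Θ F ⊆ Iio (jU hU Θ) := by
  rintro o ⟨β, hβ, g, hg, rfl⟩
  refine ordRank_lt_of_ultLT hU (Filter.mem_of_superset hg fun i hi => ?_)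
  exact lt_trans ((hF β hβ).subset i hi) hβ

theorem unbSub_ultUnion (hU : IsNormalUltrafilter δ U) (hθ : θ.IsRegular) (hδθ : δ < θ)
    (hξ : ξ < θ.ord) (hF : ∀ β < θ.ord, IsStep U ξ h C β F (F β)) :
    UnbSub (ultUnion hU θ.ord F) (jU hU θ.ord) := by
  have hlim := Cardinal.isSuccLimit_ord hθ.aleph0_le
  refine ⟨ultUnion_subset hU hF, fun b hb => ?_⟩
  obtain ⟨g, rfl, β, hβ, hg⟩ := exists_eq_ordRank_of_lt_jU hU hθ hδθ hb
  have hmax : max ξ β + 1 < θ.ord := by simpa using hlim.succ_lt (max_lt hξ hβ)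
  refine ⟨jU hU (max ξ β), ⟨_, hmax, (ordRank_mem_ultSet hU).2 (Filter.univ_mem' fun i => ?_)⟩, ?_⟩
  · exact (hF _ hmax).succ _ (le_max_left _ _) rfl i
  · exact (ordRank_lt_of_ultLT hU hg).le.trans
      ((jU_strictMono hU).monotone (le_max_right ξ β))

theorem inUlt_ultUnion_inter_Iio (hU : IsNormalUltrafilter δ U) (hθ : θ.IsRegular) (hδθ : δ < θ)
    (hF : ∀ β < θ.ord, IsStep U ξ h C β F (F β)) {α : Ordinal.{0}} (hα : α < jU hU θ.ord) :
    InUlt hU (ultUnion hU θ.ord F ∩ Iio α) := by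
  obtain ⟨g, rfl, β, hβ, hg⟩ := exists_eq_ordRank_of_lt_jU hU hθ hδθ hα
  refine ⟨fun i => F β i ∩ Iio (g i), fun i => ⟨g i, fun x hx => le_of_lt hx.2⟩, ?_⟩
  ext o
  constructor
  · rintro ⟨ho, hog⟩
    obtain ⟨g', hg', rfl⟩ := exists_ordRank_eq_of_lt hU hog
    have hg'β : {i | g' i < β} ∈ U := by
      filter_upwards [hg, hg'] with i h1 h2 using h2.trans h1
    rw [ordRank_mem_ultUnion hU hF hβ hg'β] at ho
    exact ⟨g', Filter.inter_mem ho hg', rfl⟩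
  · rintro ⟨g', hg', rfl⟩
    exact ⟨⟨β, hβ, g', Filter.mem_of_superset hg' fun i hi => hi.1, rfl⟩,
      ordRank_lt_of_ultLT hU (Filter.mem_of_superset hg' fun i hi => hi.2)⟩

theorem eventually_inter_Iio_eq (hU : IsNormalUltrafilter δ U) {Θ : Ordinal.{0}}
    (hF : ∀ β < Θ, IsStep U ξ h C β F (F β)) {D : Idx δ → Set Ordinal.{0}}
    (hD : ultUnion hU Θ F = ultSet hU D) {β : Ordinal.{0}} (hβ : β < Θ) :
    {i | D i ∩ Iio β = F β i} ∈ U := by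
  by_contra hcon
  rw [← Ultrafilter.compl_mem_iff_notMem] at hcon
  have hdiff : ∀ i, D i ∩ Iio β ≠ F β i → ∃ x < β, ¬ (x ∈ D i ↔ x ∈ F β i) := by
    intro i hi
    by_contra! hall
    refine hi (Set.ext fun x => ⟨fun hx => (hall x hx.2).1 hx.1, fun hx => ?_⟩)
    have hxβ := (hF β hβ).subset i hx
    exact ⟨(hall x hxβ).2 hx, hxβ⟩
  choose! x hxβ hx using hdiff
  have hxU : {i | x i < β} ∈ U := by
    filter_upwards [hcon] with i hi using hxβ i hi
  have hiff : {i | x i ∈ D i} ∈ U ↔ {i | x i ∈ F β i} ∈ U := by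
    rw [← ordRank_mem_ultUnion hU hF hβ hxU, hD, ordRank_mem_ultSet]
  by_cases hxD : {i | x i ∈ D i} ∈ U
  · obtain ⟨i, ⟨h1, h2⟩, h3⟩ := Ultrafilter.nonempty_of_mem
      (Filter.inter_mem (Filter.inter_mem hxD (hiff.1 hxD)) hcon)
    exact hx i h3 (iff_of_true h1 h2)
  · obtain ⟨i, ⟨h1, h2⟩, h3⟩ := Ultrafilter.nonempty_of_mem
      (Filter.inter_mem (Filter.inter_mem (Ultrafilter.compl_mem_iff_notMem.2 hxD)
        (Ultrafilter.compl_mem_iff_notMem.2 (mt hiff.2 hxD))) hcon)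
    exact hx i h3 (iff_of_false h1 h2)

theorem not_inUlt_ultUnion (hU : IsNormalUltrafilter δ U) (hθ : θ.IsRegular) (hδθ : δ < θ)
    (hξ : ξ < θ.ord) (hF : ∀ β < θ.ord, IsStep U ξ h C β F (F β))
    (hh : ∀ i < δ.ord, Stat θ {γ | ξ < γ ∧ i < h γ}) :
    ¬ InUlt hU (ultUnion hU θ.ord F) := by
  rintro ⟨D, -, hD⟩
  have hlim := Cardinal.isSuccLimit_ord hθ.aleph0_le
  have hsucc : ∀ x < θ.ord, x + 1 < θ.ord := fun x hx => by simpa using hlim.succ_lt hx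
  obtain ⟨i, hi⟩ : ∃ i, ∀ b < θ.ord, ∃ β < θ.ord, b ≤ β ∧ D i ∩ Iio (β + 1) = F (β + 1) i := by
    by_contra! hcon
    choose b hb hbD using hcon
    obtain ⟨β, hβ, hbβ⟩ := exists_bound hθ (mk_Idx_lt hδθ) b hb
    obtain ⟨i, hi⟩ := Ultrafilter.nonempty_of_mem (eventually_inter_Iio_eq hU hF hD (hsucc β hβ))
    exact hbD i β hβ (hbβ i).le hi
  have hnext : ∀ x < θ.ord, ∃ β < θ.ord, x < β ∧ β ∈ D i := by
    intro x hx
    obtain ⟨β, hβ, hle, heq⟩ := hi _ (max_lt hξ (hsucc x hx))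
    have hmem := (hF _ (hsucc β hβ)).succ β ((le_max_left _ _).trans hle) rfl i
    rw [← heq] at hmem
    exact ⟨β, hβ, Order.add_one_le_iff.1 ((le_max_right _ _).trans hle), hmem.1⟩
  choose! G hGθ hG hGD using hnext
  obtain ⟨α, ⟨hξα, hiα⟩, hαθ, h0, hcl⟩ := hh i.1 i.2 G hGθ
  have hα : α ∈ limitPts (D i) := mem_limitPts_iff.2 ⟨h0, fun x hx =>
    ⟨G x, hGD x (hx.trans hαθ), hG x (hx.trans hαθ), hcl x hx⟩⟩
  obtain ⟨β, hβ, hαβ, heq⟩ := hi α hαθ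
  have hsub := (hF _ (hsucc β hβ)).subset i
  refine hiα.not_ge ((hF _ (hsucc β hβ)).limit i α (mem_limitPts_of_inter_eq
    (hαβ.trans (Order.lt_add_one_iff.2 le_rfl).le) ?_ hα) hξα)
  rw [heq, inter_eq_left.2 hsub]

theorem fresh_ultUnion (hU : IsNormalUltrafilter δ U) (hθ : θ.IsRegular) (hδθ : δ < θ)
    (hξ : ξ < θ.ord) (hF : ∀ β < θ.ord, IsStep U ξ h C β F (F β))
    (hh : ∀ i < δ.ord, Stat θ {γ | ξ < γ ∧ i < h γ}) :
    Fresh hU (ultUnion hU θ.ord F) := by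
  refine ⟨not_inUlt_ultUnion hU hθ hδθ hξ hF hh, fun α hα =>
    inUlt_ultUnion_inter_Iio hU hθ hδθ hF (hα.trans_le (csSup_le' ?_))⟩
  rintro _ ⟨o, ho, rfl⟩
  exact Order.add_one_le_of_lt (ultUnion_subset hU hF ho)

end FreshSet

/-- If there is a regular cardinal `κ > δ⁺` and `θ ∈ {κ, κ⁺}` carrying a
`□(θ)`-sequence, then there is a limit ordinal `λ` of cofinality `θ` together with an
unbounded subset of `λ` that is fresh over `Ult(V,U)`. -/
theorem stmt9 (δ : Cardinal.{0}) (U : Ultrafilter (Idx δ)) (hU : IsNormalUltrafilter δ U)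
    (κ θ : Cardinal.{0}) (hreg : κ.IsRegular) (hκ : Order.succ δ < κ)
    (hθ : θ = κ ∨ θ = Order.succ κ)
    (hsq : ∃ C : Ordinal.{0} → Set Ordinal.{0}, IsSquareSeq θ.ord C) :
    ∃ l : Ordinal.{0}, Order.IsSuccLimit l ∧ l.cof = θ ∧
      ∃ A : Set Ordinal.{0}, UnbSub A l ∧ Fresh hU A := by
  obtain ⟨C, hC⟩ := hsq
  have hθreg : θ.IsRegular := by
    rcases hθ with rfl | rfl
    · exact hreg
    · exact isRegular_succ hreg.aleph0_le
  have hδκ : δ < κ := (Order.lt_succ δ).trans hκ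
  have hδθ : δ < θ := by
    rcases hθ with rfl | rfl
    · exact hδκ
    · exact hδκ.trans (Order.lt_succ κ)
  have hθ' : ℵ₀ < θ := hU.uncountable.trans hδθ
  obtain ⟨ξ, hξ, H, hH, hstat⟩ := exists_trace_rank hθreg hθ' hC (Cardinal.ord_lt_ord.2 hδθ)
    (Cardinal.isSuccLimit_ord hU.uncountable.le)
  obtain ⟨F, hF⟩ := exists_isStep_seq (ξ := ξ) (h := fun β => H (C β ∩ Iio ξ)) hU hC
    (fun β => hH _) fun β hβ hlim γ hγ hξγ hγβ => by
      simp only [hC.coherent β hβ hlim γ hγ hγβ, inter_Iio_inter_Iio _ hξγ.le]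
  have hcof := cof_jU_ord hU hθreg hδθ
  refine ⟨jU hU θ.ord, ?_, hcof, ultUnion hU θ.ord F, unbSub_ultUnion hU hθreg hδθ hξ hF,
    fresh_ultUnion hU hθreg hδθ hξ hF fun i hi => (hstat i hi).mono fun γ hγ => hγ.2⟩
  rw [← Ordinal.one_lt_cof_iff, ← Ordinal.aleph0_le_cof_iff, hcof]
  exact hθ'.le

end MU
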